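/- Let v : ℝ² → ℝ be a positive C² function and K : ℝ² → ℝ a continuous function with Δv(y) = K(y)·v(y) for all y ∈ ℝ², where Δ is the Euclidean Laplacian. If ∫_{ℝ²} |K(y)| dy < ∞ and ∫_{ℝ²} K(y) dy ≤ 0, then v is constant and K is identically zero. -/

import Mathlib

open MeasureTheory

/-- The Euclidean Laplacian of a function on `ℝ²`, as the trace of the second
derivative. -/
noncomputable def euclLap (v : EuclideanSpace ℝ (Fin 2) → ℝ)
    (y : EuclideanSpace ℝ (Fin 2)) : ℝ :=
  ∑ i : Fin 2,
    fderiv ℝ (fderiv ℝ v) y (EuclideanSpace.single i 1) (EuclideanSpace.single i 1)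

open Filter Topology Set

/-- The gradient `fderiv ℝ v / v` of `log v` in the direction `e`. -/
noncomputable def logGrad {E : Type*} [NormedAddCommGroup E] [NormedSpace ℝ E]
    (v : E → ℝ) (e y : E) : ℝ :=
  fderiv ℝ v y e / v y

section LogGrad

variable {E : Type*} [NormedAddCommGroup E] [NormedSpace ℝ E] {v : E → ℝ}

lemma contDiff_logGrad (hv : ContDiff ℝ 2 v) (hvpos : ∀ y, 0 < v y) (e : E) :
    ContDiff ℝ 1 (logGrad v e) :=
  ((hv.fderiv_right (m := 1) (by norm_num)).clm_apply contDiff_const).div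
    (hv.of_le (by norm_num)) fun y => (hvpos y).ne'

lemma fderiv_logGrad_self (hv : ContDiff ℝ 2 v) (hvpos : ∀ y, 0 < v y) (e y : E) :
    fderiv ℝ (logGrad v e) y e = fderiv ℝ (fderiv ℝ v) y e e / v y - logGrad v e y ^ 2 := by
  have hd : DifferentiableAt ℝ (fderiv ℝ v) y :=
    (hv.fderiv_right (m := 1) (by norm_num)).differentiable (by norm_num) y
  have h1 : HasFDerivAt (fun x => fderiv ℝ v x e) ((fderiv ℝ (fderiv ℝ v) y).flip e) y := by
    simpa using hd.hasFDerivAt.clm_apply (hasFDerivAt_const e y)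
  have h2 : HasFDerivAt v (fderiv ℝ v y) y := (hv.differentiable (by norm_num) y).hasFDerivAt
  have hne := (hvpos y).ne'
  have h3 := (h1.mul ((hasDerivAt_inv hne).comp_hasFDerivAt y h2)).fderiv
  have h4 : logGrad v e = (fun x => fderiv ℝ v x e) * ((fun x => x⁻¹) ∘ v) := by
    ext x; simp [logGrad, div_eq_mul_inv]
  rw [h4, h3]
  simp
  field_simp
  ring

end LogGrad

lemma sum_fderiv_logGrad {v K : EuclideanSpace ℝ (Fin 2) → ℝ}
    (hv : ContDiff ℝ 2 v) (hvpos : ∀ y, 0 < v y)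
    (heq : ∀ y, euclLap v y = K y * v y) (y : EuclideanSpace ℝ (Fin 2)) :
    ∑ i : Fin 2, fderiv ℝ (logGrad v (EuclideanSpace.single i 1)) y (EuclideanSpace.single i 1)
      = K y - ∑ i : Fin 2, logGrad v (EuclideanSpace.single i 1) y ^ 2 := by
  simp_rw [fderiv_logGrad_self hv hvpos, Finset.sum_sub_distrib, ← Finset.sum_div]
  have := heq y
  unfold euclLap at this
  rw [this, mul_div_cancel_right₀ _ (hvpos y).ne']

/-- Integration by parts against `φ ^ 2`, with the cross term absorbed by Young's inequality. -/
lemma neg_integral_sq_mul_fderiv_le {φ p : EuclideanSpace ℝ (Fin 2) → ℝ}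
    (hφ : ContDiff ℝ 1 φ) (hφc : HasCompactSupport φ) (hp : ContDiff ℝ 1 p)
    (e : EuclideanSpace ℝ (Fin 2)) :
    -∫ y, φ y ^ 2 * fderiv ℝ p y e ≤
      (1 / 2) * (∫ y, φ y ^ 2 * p y ^ 2) + 2 * ∫ y, fderiv ℝ φ y e ^ 2 := by
  have hφ0 := hφ.continuous
  have hp0 := hp.continuous
  have hφ1 : Continuous fun y => fderiv ℝ φ y e :=
    (hφ.continuous_fderiv (by norm_num)).clm_apply continuous_const
  have hp1 : Continuous fun y => fderiv ℝ p y e :=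
    (hp.continuous_fderiv (by norm_num)).clm_apply continuous_const
  have hsq : ∀ y, fderiv ℝ (fun y => φ y ^ 2) y e = 2 * φ y * fderiv ℝ φ y e := fun y => by
    rw [((hφ.differentiable (by norm_num) y).hasFDerivAt.pow 2).fderiv]
    simp
  have hcφ : ∀ f : EuclideanSpace ℝ (Fin 2) → ℝ, Continuous f → (∀ y, φ y = 0 → f y = 0) →
      Integrable f := fun f hf h0 =>
    hf.integrable_of_hasCompactSupport (hφc.mono fun y hy h => hy (h0 y h))
  have hi1 : Integrable fun y => fderiv ℝ (fun y => φ y ^ 2) y e * p y := by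
    simp_rw [hsq]
    exact hcφ _ (by fun_prop) fun y h => by simp [h]
  have hi2 : Integrable fun y => φ y ^ 2 * fderiv ℝ p y e :=
    hcφ _ (by fun_prop) fun y h => by simp [h]
  have hi3 : Integrable fun y => φ y ^ 2 * p y :=
    hcφ _ (by fun_prop) fun y h => by simp [h]
  have hi4 : Integrable fun y => φ y ^ 2 * p y ^ 2 :=
    hcφ _ (by fun_prop) fun y h => by simp [h]
  have hi5 : Integrable fun y => fderiv ℝ φ y e ^ 2 := by
    refine (hφ1.pow 2).integrable_of_hasCompactSupport ?_
    exact (hφc.fderiv_apply ℝ e).mono fun y hy h => hy (by simp_all)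
  rw [integral_mul_fderiv_eq_neg_fderiv_mul_of_integrable hi1 hi2 hi3
    (fun y _ => (hφ.differentiable (by norm_num) y).pow 2)
    (fun y _ => hp.differentiable (by norm_num) y), neg_neg,
    ← integral_const_mul, ← integral_const_mul,
    ← integral_add (hi4.const_mul _) (hi5.const_mul _)]
  refine integral_mono hi1 ((hi4.const_mul _).add (hi5.const_mul _)) fun y => ?_
  simp only [hsq]
  nlinarith [sq_nonneg (φ y * p y - 2 * fderiv ℝ φ y e)]

/-- Caccioppoli inequality for the gradient of `log v`. -/
lemma integral_sq_mul_logGrad_le {v K φ : EuclideanSpace ℝ (Fin 2) → ℝ}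
    (hv : ContDiff ℝ 2 v) (hvpos : ∀ y, 0 < v y) (hKcont : Continuous K)
    (heq : ∀ y, euclLap v y = K y * v y)
    (hφ : ContDiff ℝ 1 φ) (hφc : HasCompactSupport φ) :
    (1 / 2) * (∫ y, φ y ^ 2 * ∑ i : Fin 2, logGrad v (EuclideanSpace.single i 1) y ^ 2) ≤
      (∫ y, φ y ^ 2 * K y) +
        2 * ∑ i : Fin 2, ∫ y, fderiv ℝ φ y (EuclideanSpace.single i 1) ^ 2 := by
  have hp := fun i : Fin 2 => contDiff_logGrad hv hvpos (EuclideanSpace.single i 1)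
  have hp0 := fun i => (hp i).continuous
  have hp1 : ∀ i : Fin 2, Continuous fun y => fderiv ℝ (logGrad v (EuclideanSpace.single i 1)) y
      (EuclideanSpace.single i 1) := fun i =>
    ((hp i).continuous_fderiv (by norm_num)).clm_apply continuous_const
  have hi : ∀ f : EuclideanSpace ℝ (Fin 2) → ℝ, Continuous f →
      Integrable fun y => φ y ^ 2 * f y := fun f hf =>
    ((hφ.continuous.pow 2).mul hf).integrable_of_hasCompactSupport
      (hφc.mono fun y hy h => hy (by simp [h]))
  have hsum : ∫ y, φ y ^ 2 * ∑ i : Fin 2, logGrad v (EuclideanSpace.single i 1) y ^ 2 =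
      ∑ i : Fin 2, ∫ y, φ y ^ 2 * logGrad v (EuclideanSpace.single i 1) y ^ 2 := by
    simp_rw [Finset.mul_sum]
    exact integral_finsetSum _ fun i _ => hi _ ((hp0 i).pow 2)
  have hdiv : ∑ i : Fin 2, ∫ y, φ y ^ 2 * fderiv ℝ (logGrad v (EuclideanSpace.single i 1)) y
      (EuclideanSpace.single i 1) = (∫ y, φ y ^ 2 * K y) -
      ∫ y, φ y ^ 2 * ∑ i : Fin 2, logGrad v (EuclideanSpace.single i 1) y ^ 2 := by
    rw [← integral_finsetSum _ fun i _ => hi _ (hp1 i), ← integral_sub (hi _ hKcont)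
      (hi (fun y => ∑ i : Fin 2, logGrad v (EuclideanSpace.single i 1) y ^ 2)
        (continuous_finsetSum _ fun i _ => (hp0 i).pow 2))]
    congr 1 with y
    rw [← Finset.mul_sum, sum_fderiv_logGrad hv hvpos heq, mul_sub]
  have hle := Finset.sum_le_sum fun (i : Fin 2) (_ : i ∈ Finset.univ) =>
    neg_integral_sq_mul_fderiv_le hφ hφc (hp i) (EuclideanSpace.single i 1)
  rw [Finset.sum_neg_distrib, hdiv, Finset.sum_add_distrib, ← Finset.mul_sum, ← Finset.mul_sum,
    ← hsum] at hle
  linarith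

/-- The iterated logarithm `log (1 + log (1 + ‖x‖ ^ 2))`, used to build cut-off functions. -/
noncomputable def iterLog {E : Type*} [Norm E] (x : E) : ℝ :=
  Real.log (1 + Real.log (1 + ‖x‖ ^ 2))

section IterLog

lemma one_add_log_one_add_sq_pos (r : ℝ) : 0 < 1 + Real.log (1 + r ^ 2) := by
  have := Real.log_nonneg (x := 1 + r ^ 2) (by nlinarith [sq_nonneg r])
  linarith

lemma iterLog_nonneg {E : Type*} [Norm E] (x : E) : 0 ≤ iterLog x := by
  have := Real.log_nonneg (x := 1 + ‖x‖ ^ 2) (by nlinarith [sq_nonneg ‖x‖])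
  exact Real.log_nonneg (by linarith)

variable {E : Type*} [NormedAddCommGroup E] [InnerProductSpace ℝ E]

lemma contDiff_iterLog {n : WithTop ℕ∞} : ContDiff ℝ n (iterLog : E → ℝ) :=
  (contDiff_const.add ((contDiff_const.add (contDiff_norm_sq ℝ)).log fun x => by positivity)).log
    fun x => (one_add_log_one_add_sq_pos ‖x‖).ne'

lemma fderiv_iterLog_apply (x e : E) :
    fderiv ℝ iterLog x e =
      2 * inner ℝ x e / ((1 + ‖x‖ ^ 2) * (1 + Real.log (1 + ‖x‖ ^ 2))) := by
  have h0 : (1 + ‖x‖ ^ 2) ≠ 0 := by positivity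
  have h1 := (one_add_log_one_add_sq_pos ‖x‖).ne'
  have h := ((((hasStrictFDerivAt_norm_sq x).hasFDerivAt.const_add 1).log h0).const_add 1).log h1
  rw [show (iterLog : E → ℝ) = fun x => Real.log (1 + Real.log (1 + ‖x‖ ^ 2)) from rfl, h.fderiv]
  simp
  field_simp

lemma sq_fderiv_iterLog_le (x : E) {e : E} (he : ‖e‖ = 1) :
    fderiv ℝ iterLog x e ^ 2 ≤
      4 / ((1 + ‖x‖ ^ 2) * (1 + Real.log (1 + ‖x‖ ^ 2)) ^ 2) := by
  have h1 := one_add_log_one_add_sq_pos ‖x‖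
  have hin : inner ℝ x e ^ 2 ≤ 1 + ‖x‖ ^ 2 := by
    have := abs_real_inner_le_norm x e
    rw [he, mul_one] at this
    have := sq_le_sq' (by linarith [abs_le.1 this]) (abs_le.1 this).2
    linarith
  rw [fderiv_iterLog_apply, div_pow, div_le_div_iff₀ (by positivity) (by positivity)]
  calc (2 * inner ℝ x e) ^ 2 * ((1 + ‖x‖ ^ 2) * (1 + Real.log (1 + ‖x‖ ^ 2)) ^ 2)
      = inner ℝ x e ^ 2 * (4 * ((1 + ‖x‖ ^ 2) * (1 + Real.log (1 + ‖x‖ ^ 2)) ^ 2)) := by ring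
    _ ≤ (1 + ‖x‖ ^ 2) * (4 * ((1 + ‖x‖ ^ 2) * (1 + Real.log (1 + ‖x‖ ^ 2)) ^ 2)) := by gcongr
    _ = 4 * ((1 + ‖x‖ ^ 2) * (1 + Real.log (1 + ‖x‖ ^ 2))) ^ 2 := by ring

end IterLog

lemma tendsto_iterLog_cocompact {E : Type*} [NormedAddCommGroup E] [ProperSpace E] :
    Tendsto (iterLog : E → ℝ) (cocompact E) atTop := by
  have h1 : Tendsto (fun x : E => 1 + ‖x‖ ^ 2) (cocompact E) atTop :=
    tendsto_atTop_add_const_left _ _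
      ((tendsto_pow_atTop two_ne_zero).comp (tendsto_norm_cocompact_atTop (E := E)))
  exact Real.tendsto_log_atTop.comp
    (tendsto_atTop_add_const_left _ _ (Real.tendsto_log_atTop.comp h1))

lemma integrable_inv_one_add_sq_mul_log_sq :
    Integrable fun x : EuclideanSpace ℝ (Fin 2) =>
      4 / ((1 + ‖x‖ ^ 2) * (1 + Real.log (1 + ‖x‖ ^ 2)) ^ 2) := by
  refine (integrable_fun_norm_addHaar volume
    (f := fun r : ℝ => 4 / ((1 + r ^ 2) * (1 + Real.log (1 + r ^ 2)) ^ 2))).2 ?_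
  simp only [finrank_euclideanSpace, Fintype.card_fin, smul_eq_mul, Nat.add_one_sub_one, pow_one]
  refine integrableOn_Ioi_deriv_of_nonneg' (l := -0)
    (g := fun r : ℝ => -(2 * (1 + Real.log (1 + r ^ 2))⁻¹)) (fun r _ => ?_) (fun r hr => ?_) ?_
  · have h0 : 1 + r ^ 2 ≠ 0 := by positivity
    have h1 := (one_add_log_one_add_sq_pos r).ne'
    have h := (((((((hasDerivAt_id r).pow 2).const_add 1).log h0).const_add 1).inv h1).const_mul
      2).neg
    refine HasDerivAt.congr_deriv h ?_
    simp only [id, Pi.pow_apply]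
    field_simp
    push_cast
    ring
  · have := one_add_log_one_add_sq_pos r
    have : 0 < r := hr
    positivity
  · have h1 : Tendsto (fun r : ℝ => 1 + r ^ 2) atTop atTop :=
      tendsto_atTop_add_const_left _ _ (tendsto_pow_atTop two_ne_zero)
    have h2 := (tendsto_atTop_add_const_left _ (1 : ℝ)
      (Real.tendsto_log_atTop.comp h1)).inv_tendsto_atTop
    simpa using (h2.const_mul 2).neg

/-- Logarithmic cut-off functions: the plane has zero capacity at infinity. -/
lemma exists_cutoff_energy_tendsto_zero :
    ∃ φ : ℕ → EuclideanSpace ℝ (Fin 2) → ℝ,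
      (∀ n, ContDiff ℝ 1 (φ n)) ∧ (∀ n, HasCompactSupport (φ n)) ∧
      (∀ n x, 0 ≤ φ n x) ∧ (∀ n x, φ n x ≤ 1) ∧
      (∀ k, IsCompact k → ∀ᶠ n in atTop, ∀ x ∈ k, φ n x = 1) ∧
      Tendsto (fun n => ∑ i : Fin 2, ∫ y, fderiv ℝ (φ n) y (EuclideanSpace.single i 1) ^ 2)
        atTop (𝓝 0) := by
  let η : ContDiffBump (0 : ℝ) := ⟨1, 2, one_pos, one_lt_two⟩
  have hη : ContDiff ℝ 1 η := η.contDiff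
  obtain ⟨C, hC⟩ := (hη.continuous_deriv le_rfl).bounded_above_of_compact_support
    η.hasCompactSupport.deriv
  let c : ℕ → ℝ := fun n => ((n : ℝ) + 1)⁻¹
  have hc : ∀ n, 0 < c n := fun n => by positivity
  have hφ : ∀ n, ContDiff ℝ 1 fun x : EuclideanSpace ℝ (Fin 2) => η (c n * iterLog x) :=
    fun n => hη.comp (contDiff_const.mul contDiff_iterLog)
  have hφc : ∀ n, HasCompactSupport fun x : EuclideanSpace ℝ (Fin 2) => η (c n * iterLog x) := by
    intro n
    obtain ⟨t, ht, hts⟩ := mem_cocompact.1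
      ((tendsto_iterLog_cocompact (E := EuclideanSpace ℝ (Fin 2))).const_mul_atTop (hc n)
        |>.eventually_ge_atTop 2)
    refine HasCompactSupport.intro ht fun x hx => η.zero_of_le_dist ?_
    have : 2 ≤ c n * iterLog x := hts hx
    rw [Real.dist_eq, sub_zero]
    exact this.trans (le_abs_self _)
  refine ⟨fun n x => η (c n * iterLog x), hφ, hφc, fun n x => η.nonneg, fun n x => η.le_one,
    fun k hk => ?_, ?_⟩
  · obtain ⟨M, hM⟩ := hk.bddAbove_image (f := iterLog)
      (contDiff_iterLog (n := 0)).continuous.continuousOn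
    filter_upwards [tendsto_natCast_atTop_atTop.eventually_ge_atTop M] with n hn x hx
    apply η.one_of_mem_closedBall
    have hx' : iterLog x ≤ M := hM (mem_image_of_mem _ hx)
    rw [mem_closedBall_zero_iff, Real.norm_of_nonneg (mul_nonneg (hc n).le (iterLog_nonneg x))]
    change ((n : ℝ) + 1)⁻¹ * iterLog x ≤ 1
    rw [inv_mul_le_iff₀ (by positivity)]
    linarith
  · set G : EuclideanSpace ℝ (Fin 2) → ℝ := fun x =>
      4 / ((1 + ‖x‖ ^ 2) * (1 + Real.log (1 + ‖x‖ ^ 2)) ^ 2)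
    have hbound : ∀ n (i : Fin 2),
        ∫ y, fderiv ℝ (fun x : EuclideanSpace ℝ (Fin 2) => η (c n * iterLog x)) y
          (EuclideanSpace.single i 1) ^ 2 ≤ c n ^ 2 * (C ^ 2 * ∫ y, G y) := by
      intro n i
      rw [← integral_const_mul, ← integral_const_mul]
      refine integral_mono_of_nonneg (ae_of_all _ fun y => sq_nonneg _)
        ((integrable_inv_one_add_sq_mul_log_sq.const_mul _).const_mul _) (ae_of_all _ fun y => ?_)
      have h1 : HasFDerivAt (fun x : EuclideanSpace ℝ (Fin 2) => c n * iterLog x)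
          (c n • fderiv ℝ iterLog y) y :=
        ((contDiff_iterLog (n := 1)).differentiable one_ne_zero y).hasFDerivAt.const_mul _
      have h2 : HasFDerivAt (fun x : EuclideanSpace ℝ (Fin 2) => η (c n * iterLog x)) _ y :=
        (hη.differentiable one_ne_zero _).hasDerivAt.comp_hasFDerivAt y h1
      have h3 : deriv η (c n * iterLog y) ^ 2 ≤ C ^ 2 := by
        rw [← sq_abs]
        exact pow_le_pow_left₀ (abs_nonneg _) (hC _) 2
      have h4 := sq_fderiv_iterLog_le y (e := EuclideanSpace.single i (1 : ℝ)) (by simp)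
      simp only [h2.fderiv, _root_.smul_apply, smul_eq_mul]
      calc (deriv η (c n * iterLog y) * (c n * fderiv ℝ iterLog y (EuclideanSpace.single i 1))) ^ 2
          = c n ^ 2 * (deriv η (c n * iterLog y) ^ 2 *
              fderiv ℝ iterLog y (EuclideanSpace.single i 1) ^ 2) := by ring
        _ ≤ c n ^ 2 * (C ^ 2 * G y) := by gcongr
    have hc0 : Tendsto c atTop (𝓝 0) := by
      simpa [c, one_div] using tendsto_one_div_add_atTop_nhds_zero_nat (𝕜 := ℝ)
    have hlim : Tendsto (fun n => ∑ _i : Fin 2, c n ^ 2 * (C ^ 2 * ∫ y, G y)) atTop (𝓝 0) := by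
      simpa using ((hc0.pow 2).mul_const (C ^ 2 * ∫ y, G y)).const_mul 2
    exact squeeze_zero
      (fun n => Finset.sum_nonneg fun i _ => integral_nonneg fun y => sq_nonneg _)
      (fun n => Finset.sum_le_sum fun i _ => hbound n i) hlim

/-- The gradient of `log v` vanishes identically. -/
lemma sum_sq_logGrad_eq_zero {v K : EuclideanSpace ℝ (Fin 2) → ℝ}
    (hv : ContDiff ℝ 2 v) (hvpos : ∀ y, 0 < v y) (hKcont : Continuous K)
    (heq : ∀ y, euclLap v y = K y * v y)
    (hint : Integrable K) (hneg : (∫ y, K y) ≤ 0) (y : EuclideanSpace ℝ (Fin 2)) :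
    ∑ i : Fin 2, logGrad v (EuclideanSpace.single i 1) y ^ 2 = 0 := by
  obtain ⟨φ, hφ, hφc, hφ0, hφ1, hφk, hφe⟩ := exists_cutoff_energy_tendsto_zero
  set Q : EuclideanSpace ℝ (Fin 2) → ℝ :=
    fun y => ∑ i : Fin 2, logGrad v (EuclideanSpace.single i 1) y ^ 2
  have hQ : Continuous Q := continuous_finsetSum _ fun i _ =>
    (contDiff_logGrad hv hvpos _).continuous.pow 2
  have hQ0 : ∀ y, 0 ≤ Q y := fun y => Finset.sum_nonneg fun i _ => sq_nonneg _
  obtain ⟨m, hm⟩ := (hφk {y} isCompact_singleton).exists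
  have hiQ : ∀ n, Integrable fun y => φ n y ^ 2 * Q y := fun n =>
    (((hφ n).continuous.pow 2).mul hQ).integrable_of_hasCompactSupport
      ((hφc n).mono fun y hy h => hy (by simp [h]))
  have hlim : Tendsto (fun n => ∫ y, φ n y ^ 2 * K y) atTop (𝓝 (∫ y, K y)) := by
    refine tendsto_integral_of_dominated_convergence (fun y => ‖K y‖)
      (fun n => (((hφ n).continuous.pow 2).mul hKcont).aestronglyMeasurable) hint.norm
      (fun n => ae_of_all _ fun y => ?_) (ae_of_all _ fun y => ?_)
    · rw [norm_mul, Real.norm_of_nonneg (sq_nonneg _)]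
      exact mul_le_of_le_one_left (norm_nonneg _) (pow_le_one₀ (hφ0 n y) (hφ1 n y))
    · refine tendsto_const_nhds.congr' ?_
      filter_upwards [hφk {y} isCompact_singleton] with n hn
      simp [hn y rfl]
  have hle : (1 / 2) * ∫ y, φ m y ^ 2 * Q y ≤ 0 := by
    have hlim2 := hlim.add (hφe.const_mul 2)
    refine (ge_of_tendsto hlim2 ?_).trans (by simpa using hneg)
    filter_upwards [hφk _ (hφc m)] with n hn
    refine le_trans ?_ (integral_sq_mul_logGrad_le hv hvpos hKcont heq (hφ n) (hφc n))
    refine mul_le_mul_of_nonneg_left (integral_mono (hiQ m) (hiQ n) fun x => ?_) (by norm_num)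
    refine mul_le_mul_of_nonneg_right (pow_le_pow_left₀ (hφ0 m x) ?_ 2) (hQ0 x)
    by_cases hx : x ∈ tsupport (φ m)
    · exact (hφ1 m x).trans (hn x hx).ge
    · exact (image_eq_zero_of_notMem_tsupport hx).trans_le (hφ0 n x)
  by_contra hy
  have hpos : 0 < ∫ y, φ m y ^ 2 * Q y := by
    refine Continuous.integral_pos_of_hasCompactSupport_nonneg_nonzero (x := y)
      (((hφ m).continuous.pow 2).mul hQ) ((hφc m).mono fun y hy h => hy (by simp [h]))
      (fun x => mul_nonneg (sq_nonneg _) (hQ0 x)) ?_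
    rwa [hm y rfl, one_pow, one_mul]
  linarith

/-- Final step in the proof of Theorem 4.2: a positive C² solution of `Δv = K·v`
on `ℝ²` with `K` continuous, `∫|K| < ∞` and `∫ K ≤ 0` must be constant, and then
`K ≡ 0`. -/
theorem stmt_12 (v K : EuclideanSpace ℝ (Fin 2) → ℝ)
    (hv : ContDiff ℝ 2 v) (hvpos : ∀ y, 0 < v y) (hKcont : Continuous K)
    (heq : ∀ y, euclLap v y = K y * v y)
    (hint : Integrable K) (hneg : (∫ y, K y) ≤ 0) :
    (∀ y z, v y = v z) ∧ (∀ y, K y = 0) := by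
  have hfd : ∀ y, fderiv ℝ v y = 0 := by
    intro y
    have h := sum_sq_logGrad_eq_zero hv hvpos hKcont heq hint hneg y
    rw [Finset.sum_eq_zero_iff_of_nonneg fun i _ => sq_nonneg _] at h
    refine ContinuousLinearMap.coe_injective
      ((EuclideanSpace.basisFun (Fin 2) ℝ).toBasis.ext fun i => ?_)
    have hi := h i (Finset.mem_univ i)
    simpa [logGrad, (hvpos y).ne'] using hi
  refine ⟨is_const_of_fderiv_eq_zero (hv.differentiable two_ne_zero) hfd, fun y => ?_⟩
  have h := heq y
  rw [euclLap, show fderiv ℝ v = fun _ => 0 from funext hfd] at h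
  simpa [(hvpos y).ne'] using h.symm
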